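/- arXiv:1412.5423 — 4 statements merged into one kernel-verified Lean document; each statement's English description precedes it below -/
import Mathlib

section
/- Let n ≥ 2, fix a real x > 0 and j ∈ {1, …, n}, and consider the entire function of λ given by ũ_j(x; λ) := Σ_{k=0}^∞ x^{nk+j−1} λ^k/(nk+j−1)!. Then every complex zero λ of this function is real and negative, and the set of its zeros is infinite. -/
namespace MLzeros

section
open Polynomial

/-- All complex zeros are real and negative. -/
def NR (p : ℂ[X]) : Prop := ∀ z : ℂ, p.eval z = 0 → ∃ t : ℝ, t < 0 ∧ z = (t : ℂ)

lemma NR.roots {p : ℂ[X]} (hp : NR p) : ∃ T : Multiset ℝ, (∀ t ∈ T, 0 < t) ∧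
    p.roots = T.map (fun t : ℝ => -(t : ℂ)) := by
  have hroot : ∀ r ∈ p.roots, ∃ t : ℝ, t < 0 ∧ r = (t : ℂ) := fun r hr =>
    hp r (Polynomial.isRoot_of_mem_roots hr)
  refine ⟨p.roots.map (fun r => -r.re), ?_, ?_⟩
  · intro t ht
    obtain ⟨r, hr, rfl⟩ := Multiset.mem_map.1 ht
    obtain ⟨u, hu, rfl⟩ := hroot r hr
    simpa using hu
  · rw [Multiset.map_map]
    conv_lhs => rw [← Multiset.map_id p.roots]
    apply Multiset.map_congr rfl
    intro r hr
    obtain ⟨u, hu, rfl⟩ := hroot r hr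
    simp

lemma sum_im (z : ℂ) (hz : z.im ≠ 0) (T : Multiset ℝ) (hT : ∀ t ∈ T, 0 < t) :
    ∃ S : ℝ, 0 ≤ S ∧ (T.map (fun t : ℝ => z * (1 / (z + t)))).sum.im = z.im * S ∧
      (T = 0 ∨ 0 < S) := by
  induction T using Multiset.induction_on with
  | empty => exact ⟨0, le_rfl, by simp, Or.inl rfl⟩
  | cons a T ih =>
    obtain ⟨S, hS, h, -⟩ := ih (fun t ht => hT t (Multiset.mem_cons_of_mem ht))
    have ha := hT a (Multiset.mem_cons_self _ _)
    have hn : 0 < Complex.normSq (z + a) := by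
      apply Complex.normSq_pos.2
      intro h0
      apply hz
      simpa using congrArg Complex.im h0
    have hpos : 0 < a / Complex.normSq (z + a) := by positivity
    refine ⟨a / Complex.normSq (z + a) + S, by linarith, ?_, Or.inr (by linarith)⟩
    rw [Multiset.map_cons, Multiset.sum_cons, Complex.add_im, h, mul_add]
    congr 1
    rw [mul_one_div, Complex.div_im]
    simp
    field_simp
    ring

lemma sum_re (x : ℝ) (hx : 0 ≤ x) (T : Multiset ℝ) (hT : ∀ t ∈ T, 0 < t) :
    0 ≤ (T.map (fun t : ℝ => (x : ℂ) * (1 / (x + t)))).sum.re := by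
  induction T using Multiset.induction_on with
  | empty => simp
  | cons a T ih =>
    have h := ih (fun t ht => hT t (Multiset.mem_cons_of_mem ht))
    have ha := hT a (Multiset.mem_cons_self _ _)
    rw [Multiset.map_cons, Multiset.sum_cons, Complex.add_re]
    have : (x : ℂ) * (1 / (x + a)) = ((x * (1 / (x + a)) : ℝ) : ℂ) := by push_cast; rfl
    rw [this, Complex.ofReal_re]
    positivity

lemma NR.T {p : ℂ[X]} (hp : NR p) {c : ℝ} (hc : 0 < c) :
    NR (p + C ((1 / c : ℝ) : ℂ) * (X * derivative p)) := by
  intro z hz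
  by_cases h0 : p.eval z = 0
  · exact hp z h0
  have h1 := (IsAlgClosed.splits p).eval_derivative_div_eval_of_ne_zero h0
  have hcc : (c : ℂ) ≠ 0 := by exact_mod_cast hc.ne'
  have hz' : z * (p.derivative.eval z / p.eval z) = -c := by
    simp only [eval_add, eval_mul, eval_C, eval_X] at hz
    push_cast at hz
    field_simp at hz ⊢
    linear_combination hz
  obtain ⟨T, hT, hr⟩ := hp.roots
  rw [h1, ← Multiset.sum_map_mul_left, hr, Multiset.map_map] at hz'
  simp only [Function.comp_def, sub_neg_eq_add] at hz'
  have him : z.im = 0 := by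
    by_contra him
    obtain ⟨S, hS, h, h'⟩ := sum_im z him T hT
    rw [hz'] at h
    rcases h' with h' | h'
    · subst h'
      simp at hz'
      exact hc.ne' hz'
    · simp at h
      rcases h with h | h
      · exact him h
      · exact h'.ne' h
  have hzz : z = (z.re : ℂ) := Complex.ext rfl (by simpa using him)
  refine ⟨z.re, ?_, hzz⟩
  by_contra hneg
  push Not at hneg
  have h := sum_re z.re hneg T hT
  rw [← hzz, hz'] at h
  simp at h
  linarith

lemma key (z : ℂ) (hz : ¬ ∃ t : ℝ, t < 0 ∧ z = (t : ℂ)) :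
    ∃ K : ℝ, ∀ t : ℝ, 0 ≤ t → Real.exp (-(K * t)) ≤ ‖1 + z * t‖ := by
  by_cases him : z.im = 0
  · refine ⟨0, fun t ht => ?_⟩
    have hre : 0 ≤ z.re := by
      by_contra h
      exact hz ⟨z.re, not_le.1 h, Complex.ext rfl (by simpa using him)⟩
    have h1 : (1 + z * t).re = 1 + z.re * t := by simp
    have := Complex.re_le_norm (1 + z * t)
    rw [h1] at this
    have h2 := mul_nonneg hre ht
    simp; linarith
  · have hz0 : 0 < ‖z‖ := norm_pos_iff.2 (fun h => him (by simp [h]))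
    have hi : 0 < |z.im| := abs_pos.2 him
    set s := |z.im| / ‖z‖ with hs
    have hs0 : 0 < s := by positivity
    have hs1 : s ≤ 1 := by
      rw [hs, div_le_one hz0]; exact Complex.abs_im_le_norm z
    have hl : Real.log s ≤ 0 := Real.log_nonpos hs0.le hs1
    have hlow : ∀ t : ℝ, s ≤ ‖1 + z * t‖ := by
      intro t
      rw [hs, div_le_iff₀ hz0]
      have h1 : ((1 + z * t) * (starRingEnd ℂ) z).im = - z.im := by
        simp; ring
      have h2 := Complex.abs_im_le_norm ((1 + z * t) * (starRingEnd ℂ) z)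
      rw [h1, norm_mul, abs_neg, Complex.norm_conj] at h2
      exact h2
    refine ⟨2 * ‖z‖ + 2 * ‖z‖ * (- Real.log s), fun t ht => ?_⟩
    have hn : 0 ≤ ‖z‖ * t := by positivity
    by_cases hu : ‖z‖ * t ≤ 1 / 2
    · have h1 : 1 - ‖z‖ * t ≤ ‖1 + z * t‖ := by
        have := norm_sub_norm_le (1 : ℂ) (-(z * t))
        simp only [norm_neg, norm_mul, Complex.norm_real, norm_one, sub_neg_eq_add,
          Real.norm_eq_abs, abs_of_nonneg ht] at this
        exact this
      refine le_trans ?_ h1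
      calc Real.exp (-((2 * ‖z‖ + 2 * ‖z‖ * (- Real.log s)) * t)) ≤ Real.exp (-(2 * (‖z‖ * t))) := by
            apply Real.exp_le_exp.2
            nlinarith [mul_nonneg hn (neg_nonneg.2 hl)]
        _ ≤ 1 - ‖z‖ * t := by
            rw [Real.exp_neg]
            apply inv_le_of_inv_le₀ (by linarith)
            have h3 := Real.add_one_le_exp (2 * (‖z‖ * t))
            refine le_trans ?_ h3
            rw [inv_le_iff_one_le_mul₀ (by linarith)]
            nlinarith
    · refine le_trans ?_ (hlow t)
      rw [← Real.le_log_iff_exp_le hs0]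
      push Not at hu
      nlinarith [mul_nonneg (sub_nonneg.2 hu.le) (neg_nonneg.2 hl)]

lemma prod_lower (z : ℂ) (K : ℝ)
    (hK : ∀ t : ℝ, 0 ≤ t → Real.exp (-(K * t)) ≤ ‖1 + z * t‖)
    (T : Multiset ℝ) (hT : ∀ t ∈ T, 0 < t) :
    Real.exp (-(K * (T.map (fun t => t⁻¹)).sum)) ≤
        ‖(T.map (fun t : ℝ => 1 + z * (t⁻¹ : ℝ))).prod‖ ∧
      0 ≤ (T.map (fun t => t⁻¹)).sum ∧
      (T.map (fun t : ℝ => z + t)).prod =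
        (T.map (fun t : ℝ => (t : ℂ))).prod * (T.map (fun t : ℝ => 1 + z * (t⁻¹ : ℝ))).prod ∧
      (T.map (fun t : ℝ => (1 : ℂ) / t)).sum = ((T.map (fun t => t⁻¹)).sum : ℝ) := by
  induction T using Multiset.induction_on with
  | empty => simp
  | cons a T ih =>
    obtain ⟨h1, h2, h3, h4⟩ := ih (fun t ht => hT t (Multiset.mem_cons_of_mem ht))
    have ha := hT a (Multiset.mem_cons_self _ _)
    have hac : (a : ℂ) ≠ 0 := by exact_mod_cast ha.ne'
    simp only [Multiset.map_cons, Multiset.sum_cons, Multiset.prod_cons]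
    refine ⟨?_, by positivity, ?_, ?_⟩
    · rw [norm_mul, mul_add, neg_add, Real.exp_add]
      exact mul_le_mul (hK _ (by positivity)) h1 (by positivity) (by positivity)
    · rw [h3]
      push_cast
      field_simp
      ring
    · rw [h4]; push_cast; ring

lemma lower (z : ℂ) (hz : ¬ ∃ t : ℝ, t < 0 ∧ z = (t : ℂ)) :
    ∃ K : ℝ, ∀ p : ℂ[X], NR p → p.coeff 0 = 1 → Real.exp (-(K * ‖p.coeff 1‖)) ≤ ‖p.eval z‖ := by
  obtain ⟨K, hK⟩ := key z hz
  refine ⟨K, fun p hp h0 => ?_⟩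
  obtain ⟨T, hT, hr⟩ := hp.roots
  have hs := IsAlgClosed.splits p
  have e0 : p.eval 0 = 1 := by rw [← coeff_zero_eq_eval_zero, h0]
  have h1 := hs.eval_derivative_div_eval_of_ne_zero (x := 0) (by simp [e0])
  have h2 : p.derivative.eval 0 = p.coeff 1 := by
    rw [← coeff_zero_eq_eval_zero, coeff_derivative]; simp
  obtain ⟨g1, g2, g3, g4⟩ := prod_lower z K hK T hT
  rw [h2, e0, div_one, hr, Multiset.map_map] at h1
  simp only [Function.comp_def, sub_neg_eq_add, zero_add] at h1
  rw [g4] at h1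
  have h5 := hs.eval_eq_prod_roots z
  have h6 := hs.eval_eq_prod_roots 0
  rw [hr, Multiset.map_map] at h5 h6
  simp only [Function.comp_def, sub_neg_eq_add, zero_add] at h5 h6
  rw [g3, ← mul_assoc, ← h6, e0, one_mul] at h5
  rw [h5, h1, Complex.norm_real, Real.norm_eq_abs, abs_of_nonneg g2]
  exact g1

lemma exists_poly {ι : Type*} (N : ℕ) (d : ℝ) (hd : 0 < d) (S : Finset ι) (c : ι → ℝ)
    (hc : ∀ i ∈ S, 0 < c i) :
    ∃ p : ℂ[X], NR p ∧ ∀ k, p.coeff k =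
      (((N.choose k : ℝ) * d ^ k * ∏ i ∈ S, (1 + k / c i) : ℝ) : ℂ) := by
  classical
  induction S using Finset.induction_on with
  | empty =>
    refine ⟨((1 + X) ^ N : ℂ[X]).comp (C (d : ℂ) * X), ?_, fun k => ?_⟩
    · intro z hz
      have h : 1 + (d : ℂ) * z = 0 := by
        simp at hz
        exact hz.1
      refine ⟨-(1 / d), by simpa using hd, ?_⟩
      have : (d : ℂ) ≠ 0 := by exact_mod_cast hd.ne'
      push_cast
      field_simp
      linear_combination h
    · rw [comp_C_mul_X_coeff, coeff_one_add_X_pow]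
      simp
  | insert a S ha ih =>
    obtain ⟨p, hp, hk⟩ := ih (fun i hi => hc i (Finset.mem_insert_of_mem hi))
    refine ⟨_, hp.T (hc a (Finset.mem_insert_self _ _)), fun k => ?_⟩
    rw [Finset.prod_insert ha, coeff_add, coeff_C_mul, hk]
    cases k with
    | zero => simp
    | succ k =>
      rw [coeff_X_mul, coeff_derivative, hk]
      push_cast
      ring

lemma teles (b : ℝ) (hb : 0 < b) (N k : ℕ) :
    ∏ s ∈ Finset.range N, (1 + (k : ℝ) / (b + s)) = ∏ l ∈ Finset.range k, ((b + N + l) / (b + l)) := by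
  induction N with
  | zero =>
    symm; apply Finset.prod_eq_one
    intro l _
    have : b + l ≠ 0 := by positivity
    simp [this]
  | succ N ih =>
    rw [Finset.prod_range_succ, ih]
    have h : ∀ k : ℕ, ∏ l ∈ Finset.range k, ((b + (N + 1 : ℕ) + l) / (b + l)) =
        (∏ l ∈ Finset.range k, ((b + N + l) / (b + l))) * (1 + (k : ℝ) / (b + N)) := by
      intro k
      induction k with
      | zero => simp
      | succ k ih2 =>
        rw [Finset.prod_range_succ, ih2, Finset.prod_range_succ]
        push_cast
        have h1 : b + N ≠ 0 := by positivity
        have h2 : b + k ≠ 0 := by positivity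
        field_simp
        ring
    rw [h]

open Filter Topology in
lemma nonvan {ι : Type*} (I : Finset ι) (b : ι → ℝ) (hb : ∀ i, 0 < b i) (z : ℂ)
    (hz : ¬ ∃ t : ℝ, t < 0 ∧ z = (t : ℂ)) :
    ∑' k : ℕ, ((∏ l ∈ Finset.range k, (((l : ℝ) + 1)⁻¹ * ∏ i ∈ I, (b i + l)⁻¹) : ℝ) : ℂ) * z ^ k
      ≠ 0 := by
  classical
  set A : ℕ → ℝ := fun k => ∏ l ∈ Finset.range k, (((l : ℝ) + 1)⁻¹ * ∏ i ∈ I, (b i + l)⁻¹) with hA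
  set h : ℕ → ℕ → ℝ := fun N l => (((N - l : ℕ) : ℝ) / N) * ∏ i ∈ I, ((b i + N + l) / N) with hh
  set B : ℝ := ∏ i ∈ I, (b i + 2) with hB
  set D : ℝ := ∏ i ∈ I, (b i)⁻¹ with hD
  have hB0 : 0 ≤ B := Finset.prod_nonneg fun i _ => by have := hb i; positivity
  have hD0 : 0 ≤ D := Finset.prod_nonneg fun i _ => by have := hb i; positivity
  have hA0 : ∀ k, 0 ≤ A k := fun k => Finset.prod_nonneg fun l _ =>
    mul_nonneg (by positivity) (Finset.prod_nonneg fun i _ => by have := hb i; positivity)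
  have hAle : ∀ k, A k ≤ D ^ k / k.factorial := by
    intro k
    have h1 : D ^ k / k.factorial = ∏ l ∈ Finset.range k, (((l : ℝ) + 1)⁻¹ * D) := by
      rw [Finset.prod_mul_distrib, Finset.prod_const, Finset.card_range, Finset.prod_inv_distrib,
        ← Finset.prod_range_add_one_eq_factorial]
      push_cast
      field_simp
    rw [h1]
    refine Finset.prod_le_prod (fun l _ => mul_nonneg (by positivity)
      (Finset.prod_nonneg fun i _ => by have := hb i; positivity)) fun l _ => ?_
    refine mul_le_mul_of_nonneg_left ?_ (by positivity)
    refine Finset.prod_le_prod (fun i _ => by have := hb i; positivity) fun i _ => ?_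
    have := hb i
    gcongr
    have : (0 : ℝ) ≤ l := by positivity
    linarith
  have hh0 : ∀ N l, 0 ≤ h N l := fun N l =>
    mul_nonneg (by positivity) (Finset.prod_nonneg fun i _ => by have := hb i; positivity)
  have hhB : ∀ N, 1 ≤ N → ∀ l, h N l ≤ B := by
    intro N hN l
    have hNr : (1 : ℝ) ≤ N := by exact_mod_cast hN
    by_cases hl : l ≤ N
    · have hlr : (l : ℝ) ≤ N := by exact_mod_cast hl
      have h1 : ((N - l : ℕ) : ℝ) / N ≤ 1 := by
        rw [div_le_one (by linarith)]
        exact_mod_cast Nat.sub_le N l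
      have h2 : ∏ i ∈ I, ((b i + N + l) / N) ≤ B := by
        refine Finset.prod_le_prod (fun i _ => by have := hb i; positivity) fun i _ => ?_
        rw [div_le_iff₀ (by linarith)]
        nlinarith [hb i]
      calc h N l ≤ 1 * B := mul_le_mul h1 h2
            (Finset.prod_nonneg fun i _ => by have := hb i; positivity) zero_le_one
        _ = B := one_mul B
    · have : N - l = 0 := by omega
      simp [hh, this, hB0]
  have hlim : ∀ l, Tendsto (fun N => h N l) atTop (𝓝 1) := by
    intro l
    have hc : ∀ c : ℝ, Tendsto (fun N : ℕ => 1 + c / (N : ℝ)) atTop (𝓝 1) := by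
      intro c
      simpa using (tendsto_const_div_atTop_nhds_zero_nat c).const_add 1
    have h1 : Tendsto (fun N : ℕ => ((N - l : ℕ) : ℝ) / N) atTop (𝓝 1) := by
      refine (hc (-l)).congr' ?_
      filter_upwards [eventually_ge_atTop (l + 1)] with N hN
      have : (N : ℝ) ≠ 0 := by
        have : N ≠ 0 := by omega
        exact_mod_cast this
      rw [Nat.cast_sub (by omega)]
      field_simp
      ring
    have h2 : Tendsto (fun N : ℕ => ∏ i ∈ I, ((b i + N + l) / N)) atTop (𝓝 (∏ i ∈ I, 1)) := by
      apply tendsto_finsetProd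
      intro i _
      refine (hc (b i + l)).congr' ?_
      filter_upwards [eventually_ge_atTop 1] with N hN
      have : (N : ℝ) ≠ 0 := by
        have : N ≠ 0 := by omega
        exact_mod_cast this
      field_simp
      ring
    simpa [hh] using h1.mul h2
  set g : ℕ → ℕ → ℝ := fun N k => ∏ l ∈ Finset.range k, h N l with hg
  have hgB : ∀ N, 1 ≤ N → ∀ k, g N k ≤ B ^ k := by
    intro N hN k
    calc g N k ≤ ∏ l ∈ Finset.range k, B :=
          Finset.prod_le_prod (fun l _ => hh0 N l) fun l _ => hhB N hN l
      _ = B ^ k := by simp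
  have hg0 : ∀ N k, 0 ≤ g N k := fun N k => Finset.prod_nonneg fun l _ => hh0 N l
  have hpoly : ∀ N : ℕ, 1 ≤ N → ∃ p : ℂ[X], NR p ∧ ∀ k, p.coeff k = ((A k * g N k : ℝ) : ℂ) := by
    intro N hN
    have hN0 : (0 : ℝ) < N := by exact_mod_cast hN
    obtain ⟨p, hp, hk⟩ := exists_poly N (((N : ℝ) ^ (I.card + 1))⁻¹) (by positivity)
      (I ×ˢ Finset.range N) (fun q => b q.1 + q.2) (fun q _ => by have := hb q.1; positivity)
    refine ⟨p, hp, fun k => ?_⟩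
    rw [hk k]
    congr 1
    rw [Finset.prod_product]
    simp only
    rw [Finset.prod_congr rfl (fun i _ => teles (b i) (hb i) N k), Finset.prod_comm]
    have hch : (N.choose k : ℝ) = ∏ l ∈ Finset.range k, (((N - l : ℕ) : ℝ) * ((l : ℝ) + 1)⁻¹) := by
      rw [Finset.prod_mul_distrib, Finset.prod_inv_distrib]
      have e1 : (∏ l ∈ Finset.range k, ((l : ℝ) + 1)) = k.factorial := by
        rw [← Finset.prod_range_add_one_eq_factorial]; push_cast; rfl
      have e2 : (∏ l ∈ Finset.range k, ((N - l : ℕ) : ℝ)) = N.descFactorial k := by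
        rw [Nat.descFactorial_eq_prod_range]; push_cast; rfl
      rw [e1, e2, Nat.descFactorial_eq_factorial_mul_choose]
      push_cast
      field_simp
    have hd : (((N : ℝ) ^ (I.card + 1))⁻¹) ^ k = ∏ l ∈ Finset.range k, ((N : ℝ) ^ (I.card + 1))⁻¹ := by
      simp
    rw [hch, hd, ← Finset.prod_mul_distrib, ← Finset.prod_mul_distrib, hA, hg,
      ← Finset.prod_mul_distrib]
    refine Finset.prod_congr rfl fun l _ => ?_
    simp only [hh, Finset.prod_div_distrib, Finset.prod_const, Finset.prod_inv_distrib]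
    have : ∏ i ∈ I, (b i + (l : ℝ)) ≠ 0 :=
      Finset.prod_ne_zero_iff.2 fun i _ => by have := hb i; positivity
    field_simp
    ring
  have hsum : Summable (fun k : ℕ => (D * B * ‖z‖) ^ k / k.factorial) :=
    Real.summable_pow_div_factorial _
  have htend : Tendsto (fun N => ∑' k, ((A k * g N k : ℝ) : ℂ) * z ^ k) atTop
      (𝓝 (∑' k, ((A k : ℝ) : ℂ) * z ^ k)) := by
    refine tendsto_tsum_of_dominated_convergence hsum (fun k => ?_) ?_
    · have : Tendsto (fun N => g N k) atTop (𝓝 1) := by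
        simpa using tendsto_finsetProd (Finset.range k) (fun l _ => hlim l)
      have h2 : Tendsto (fun N => A k * g N k) atTop (𝓝 (A k)) := by
        simpa using this.const_mul (A k)
      exact ((Complex.continuous_ofReal.tendsto _).comp h2).mul_const _
    · filter_upwards [eventually_ge_atTop 1] with N hN k
      rw [norm_mul, Complex.norm_real, norm_pow, Real.norm_eq_abs,
        abs_of_nonneg (mul_nonneg (hA0 k) (hg0 N k))]
      calc A k * g N k * ‖z‖ ^ k ≤ (D ^ k / k.factorial) * B ^ k * ‖z‖ ^ k := by
            gcongr
            · exact hg0 N k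
            · exact hAle k
            · exact hgB N hN k
        _ = _ := by rw [mul_pow, mul_pow]; ring
  obtain ⟨K, hK⟩ := lower z hz
  have hbound : ∀ᶠ N in atTop, Real.exp (-(|K| * (A 1 * B))) ≤
      ‖∑' k, ((A k * g N k : ℝ) : ℂ) * z ^ k‖ := by
    filter_upwards [eventually_ge_atTop 1] with N hN
    obtain ⟨p, hp, hk⟩ := hpoly N hN
    have e : ∑' k, ((A k * g N k : ℝ) : ℂ) * z ^ k = p.eval z := by
      rw [Polynomial.eval_eq_sum_range, tsum_eq_sum (s := Finset.range (p.natDegree + 1))]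
      · exact Finset.sum_congr rfl fun k _ => by rw [hk]
      · intro k hk'
        rw [← hk, Polynomial.coeff_eq_zero_of_natDegree_lt, zero_mul]
        simpa using hk'
    rw [e]
    refine le_trans (Real.exp_le_exp.2 ?_) (hK p hp ?_)
    · rw [hk, Complex.norm_real, Real.norm_eq_abs, abs_of_nonneg (mul_nonneg (hA0 1) (hg0 N 1))]
      have h1 : A 1 * g N 1 ≤ A 1 * B := by
        have := hgB N hN 1
        rw [pow_one] at this
        exact mul_le_mul_of_nonneg_left this (hA0 1)
      have h2 : K * (A 1 * g N 1) ≤ |K| * (A 1 * B) :=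
        mul_le_mul (le_abs_self K) h1 (mul_nonneg (hA0 1) (hg0 N 1)) (abs_nonneg K)
      linarith
    · rw [hk]; simp [hA, hg]
  have hfin := ge_of_tendsto htend.norm hbound
  intro h0
  rw [h0, norm_zero] at hfin
  exact absurd hfin (not_le.2 (Real.exp_pos _))

lemma coeff_id (n m : ℕ) (hm : m < n) (k : ℕ) :
    (∏ l ∈ Finset.range k, (((l : ℝ) + 1)⁻¹ *
      ∏ i ∈ (Finset.range n).erase (n - 1 - m), (((m + 1 + i : ℕ) : ℝ) / n + l)⁻¹)) *
      ((n * k + m).factorial : ℝ) = m.factorial * (n : ℝ) ^ (n * k) := by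
  have hn : (n : ℝ) ≠ 0 := by
    have : n ≠ 0 := by omega
    exact_mod_cast this
  induction k with
  | zero => simp
  | succ k ih =>
    rw [Finset.prod_range_succ]
    have e1 : ((k : ℝ) + 1)⁻¹ = (((m + 1 + (n - 1 - m) : ℕ) : ℝ) / n + k)⁻¹ := by
      have : m + 1 + (n - 1 - m) = n := by omega
      rw [this, div_self hn, add_comm]
    rw [e1, Finset.mul_prod_erase (Finset.range n)
      (fun i => (((m + 1 + i : ℕ) : ℝ) / n + k)⁻¹) (by simp; omega)]
    have e2 : n * (k + 1) + m = n * k + m + n := by ring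
    rw [e2, ← Nat.factorial_mul_ascFactorial, Nat.ascFactorial_eq_prod_range]
    have e3 : ((∏ i ∈ Finset.range n, (n * k + m + 1 + i) : ℕ) : ℝ) =
        (n : ℝ) ^ n * ∏ i ∈ Finset.range n, (((m + 1 + i : ℕ) : ℝ) / n + k) := by
      have : (n : ℝ) ^ n = ∏ i ∈ Finset.range n, (n : ℝ) := by simp
      rw [this, ← Finset.prod_mul_distrib]
      push_cast
      refine Finset.prod_congr rfl fun i _ => ?_
      field_simp
      ring
    have e4 : ∏ i ∈ Finset.range n, (((m + 1 + i : ℕ) : ℝ) / n + k) ≠ 0 :=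
      Finset.prod_ne_zero_iff.2 fun i _ => by
        have : (0 : ℝ) < n := by positivity
        positivity
    rw [Nat.cast_mul, e3, Finset.prod_inv_distrib, Nat.mul_succ, pow_add, ← mul_assoc (m.factorial : ℝ), ← ih]
    generalize (∏ l ∈ Finset.range k, (((l : ℝ) + 1)⁻¹ *
      ∏ i ∈ (Finset.range n).erase (n - 1 - m), (((m + 1 + i : ℕ) : ℝ) / n + l)⁻¹)) = P
    generalize ∏ i ∈ Finset.range n, (((m + 1 + i : ℕ) : ℝ) / n + k) = Q at e4 ⊢
    field_simp

lemma partA (n m : ℕ) (hm : m < n) (x : ℝ) (hx : 0 < x) (lam : ℂ)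
    (hl : ∑' k : ℕ, (x : ℂ) ^ (n * k + m) * lam ^ k / ((n * k + m).factorial : ℂ) = 0) :
    ∃ t : ℝ, t < 0 ∧ lam = (t : ℂ) := by
  by_contra hcon
  have hn : (0 : ℝ) < n := by
    have : 0 < n := by omega
    exact_mod_cast this
  have hy : 0 < (x / n) ^ n := by positivity
  refine nonvan ((Finset.range n).erase (n - 1 - m)) (fun i => ((m + 1 + i : ℕ) : ℝ) / n)
    (fun i => by positivity) (lam * ((x / n) ^ n : ℝ)) ?_ ?_
  · rintro ⟨t, ht, h⟩
    refine hcon ⟨t / (x / n) ^ n, div_neg_of_neg_of_pos ht hy, ?_⟩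
    have : (((x / n) ^ n : ℝ) : ℂ) ≠ 0 := by exact_mod_cast hy.ne'
    rw [Complex.ofReal_div, eq_div_iff this, h]
  · have hx0 : (x : ℂ) ≠ 0 := by exact_mod_cast hx.ne'
    have hn0 : (n : ℂ) ≠ 0 := by exact_mod_cast hn.ne'
    have hmf : (m.factorial : ℂ) ≠ 0 := by exact_mod_cast m.factorial_ne_zero
    rw [← mul_right_inj' (a := (x : ℂ) ^ m / m.factorial) (by positivity), mul_zero, ← hl,
      ← tsum_mul_left]
    refine tsum_congr fun k => ?_
    have h := coeff_id n m hm k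
    have hc := congrArg (fun r : ℝ => (r : ℂ)) h
    rw [Complex.ofReal_mul] at hc
    set P := ((∏ l ∈ Finset.range k, (((l : ℝ) + 1)⁻¹ *
      ∏ i ∈ (Finset.range n).erase (n - 1 - m), (((m + 1 + i : ℕ) : ℝ) / n + l)⁻¹) : ℝ) : ℂ) with hP
    have hf : ((n * k + m).factorial : ℂ) ≠ 0 := by exact_mod_cast (n * k + m).factorial_ne_zero
    have hP' : P = m.factorial * (n : ℂ) ^ (n * k) / ((n * k + m).factorial : ℂ) := by
      rw [eq_div_iff hf]
      push_cast at hc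
      exact hc
    rw [hP']
    push_cast
    rw [mul_pow, ← pow_mul, div_pow, pow_add]
    field_simp

/-- The phases. -/
noncomputable def th (n q : ℕ) : ℝ := (2 * q + 1) * Real.pi / n

noncomputable def G (n m : ℕ) (t : ℝ) : ℝ :=
  ∑ q ∈ Finset.range n, Real.exp (t * Real.cos (th n q)) *
    Real.cos (t * Real.sin (th n q) - m * th n q)

lemma G_term (th : ℝ) (m : ℕ) (t : ℝ) :
    HasSum (fun l : ℕ => t ^ l / l.factorial * Real.cos (((l : ℝ) - m) * th))
      (Real.exp (t * Real.cos th) * Real.cos (t * Real.sin th - m * th)) := by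
  have h := (NormedSpace.expSeries_div_hasSum_exp (𝔸 := ℂ)
    ((t : ℂ) * Complex.exp (th * Complex.I))).mul_right (Complex.exp (-(m * th) * Complex.I))
  have h2 := Complex.hasSum_re h
  rw [← Complex.exp_eq_exp_ℂ, ← Complex.exp_add] at h2
  convert h2 using 1
  · funext l
    have e : ((t : ℂ) * Complex.exp (th * Complex.I)) ^ l / (l.factorial : ℂ) *
        Complex.exp (-(m * th) * Complex.I) =
        ((t ^ l / l.factorial : ℝ) : ℂ) * Complex.exp ((((l : ℝ) - m) * th : ℝ) * Complex.I) := by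
      rw [mul_pow, ← Complex.exp_nat_mul]
      push_cast
      have : Complex.exp (((l : ℂ) - m) * th * Complex.I) =
          Complex.exp (l * (th * Complex.I)) * Complex.exp (-(m * th) * Complex.I) := by
        rw [← Complex.exp_add]; congr 1; ring
      rw [this]; ring
    rw [e, Complex.re_ofReal_mul, Complex.exp_ofReal_mul_I_re]
  · rw [Complex.exp_re]
    congr 2
    · simp [Complex.exp_ofReal_mul_I_re]
    · simp [Complex.exp_ofReal_mul_I_im]; ring

lemma cos_sum (n : ℕ) (hn : 0 < n) (d : ℤ) (hd : ¬ (n : ℤ) ∣ d) :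
    ∑ q ∈ Finset.range n, Real.cos ((d : ℝ) * th n q) = 0 := by
  have hn0 : (n : ℂ) ≠ 0 := by exact_mod_cast hn.ne'
  set w : ℂ := Complex.exp (2 * Real.pi * Complex.I * (d / n)) with hw
  have hwn : w ^ n = 1 := by
    rw [hw, ← Complex.exp_nat_mul, Complex.exp_eq_one_iff]
    exact ⟨d, by field_simp⟩
  have hw1 : w ≠ 1 := by
    intro h
    rw [hw, Complex.exp_eq_one_iff] at h
    obtain ⟨k, hk⟩ := h
    apply hd
    refine ⟨k, ?_⟩
    have hpi : (2 * Real.pi * Complex.I : ℂ) ≠ 0 := Complex.two_pi_I_ne_zero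
    have : (d : ℂ) / n = k := by
      apply mul_left_cancel₀ hpi
      rw [hk]; ring
    rw [div_eq_iff hn0] at this
    have h2 : d = k * n := by exact_mod_cast this
    rw [h2, mul_comm]
  have hs : ∑ q ∈ Finset.range n, w ^ q = 0 := by
    rw [geom_sum_eq hw1, hwn]; simp
  have h3 : ∀ q : ℕ, Real.cos ((d : ℝ) * th n q) =
      (Complex.exp (d * Real.pi / n * Complex.I) * w ^ q).re := by
    intro q
    rw [hw, ← Complex.exp_nat_mul, ← Complex.exp_add, ← Complex.exp_ofReal_mul_I_re]
    congr 2
    simp only [th]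
    push_cast
    field_simp
    ring
  simp_rw [h3]
  rw [← Complex.re_sum, ← Finset.mul_sum, hs]
  simp

lemma G_hasSum (n m : ℕ) (hm : m < n) (t : ℝ) :
    HasSum (fun k : ℕ => t ^ (n * k + m) / (n * k + m).factorial * (n * (-1) ^ k)) (G n m t) := by
  have hn : 0 < n := by omega
  have hn0 : (n : ℝ) ≠ 0 := by exact_mod_cast hn.ne'
  have h := hasSum_sum (s := Finset.range n) (fun q _ => G_term (th n q) m t)
  have hinj : Function.Injective (fun k : ℕ => n * k + m) := by
    intro a b hab
    simpa [hn.ne'] using hab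
  rw [← hinj.hasSum_iff] at h
  · unfold G
    convert h using 1
    funext k
    simp only [Function.comp]
    rw [← Finset.mul_sum]
    congr 1
    have : ∀ q ∈ Finset.range n, Real.cos ((((n * k + m : ℕ) : ℝ) - m) * th n q) = (-1) ^ k := by
      intro q _
      have e : (((n * k + m : ℕ) : ℝ) - m) * th n q = k * Real.pi + ((k * q : ℕ) : ℝ) * (2 * Real.pi) := by
        simp only [th]
        push_cast
        field_simp
        ring
      rw [e, Real.cos_add_nat_mul_two_pi, Real.cos_nat_mul_pi]
    rw [Finset.sum_congr rfl this]
    simp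
  · intro l hl
    rw [← Finset.mul_sum]
    have hc := cos_sum n hn ((l : ℤ) - m) (by
      rintro ⟨c, hc⟩
      apply hl
      have hc0 : 0 ≤ c := by
        by_contra hneg
        have : c ≤ -1 := by omega
        nlinarith
      refine ⟨c.toNat, ?_⟩
      zify
      rw [Int.toNat_of_nonneg hc0]
      linarith)
    push_cast at hc
    rw [hc, mul_zero]

lemma G_cont (n m : ℕ) : Continuous (G n m) := by
  unfold G
  fun_prop

open Filter Topology in
lemma G_asymp (n m : ℕ) (hn : 2 ≤ n) :
    Tendsto (fun t => G n m t * Real.exp (-(t * Real.cos (Real.pi / n))) -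
      2 * Real.cos (t * Real.sin (Real.pi / n) - m * (Real.pi / n))) atTop (𝓝 0) := by
  obtain ⟨N, rfl⟩ : ∃ N, n = N + 2 := ⟨n - 2, by omega⟩
  set n := N + 2 with hnN
  have hn0 : (0 : ℝ) < n := by positivity
  have hpi := Real.pi_pos
  have hG : ∀ t, G n m t * Real.exp (-(t * Real.cos (Real.pi / n))) -
      2 * Real.cos (t * Real.sin (Real.pi / n) - m * (Real.pi / n)) =
      ∑ q ∈ Finset.range N, Real.exp (t * (Real.cos (th n (q + 1)) - Real.cos (Real.pi / n))) *
        Real.cos (t * Real.sin (th n (q + 1)) - m * th n (q + 1)) := by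
    intro t
    have t0 : th n 0 = Real.pi / n := by simp [th]
    have t1 : th n (N + 1) = 2 * Real.pi - Real.pi / n := by
      have : (n : ℝ) = N + 2 := by rw [hnN]; push_cast; ring
      simp only [th]
      field_simp
      rw [this]; push_cast; ring
    have c1 : Real.cos (th n (N + 1)) = Real.cos (Real.pi / n) := by
      rw [t1, Real.cos_two_pi_sub]
    have s1 : Real.sin (th n (N + 1)) = -Real.sin (Real.pi / n) := by
      rw [t1, Real.sin_two_pi_sub]
    have c2 : Real.cos (t * Real.sin (th n (N + 1)) - m * th n (N + 1)) =
        Real.cos (t * Real.sin (Real.pi / n) - m * (Real.pi / n)) := by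
      rw [s1, t1, ← Real.cos_neg]
      have : -(t * -Real.sin (Real.pi / n) - m * (2 * Real.pi - Real.pi / n)) =
        (t * Real.sin (Real.pi / n) - m * (Real.pi / n)) + m * (2 * Real.pi) := by ring
      rw [this, Real.cos_add_nat_mul_two_pi]
    have e1 : Real.exp (t * Real.cos (Real.pi / n)) * Real.exp (-(t * Real.cos (Real.pi / n))) = 1 := by
      rw [← Real.exp_add]; simp
    have hGd : G n m t = ∑ q ∈ Finset.range (N + 1 + 1), Real.exp (t * Real.cos (th n q)) *
        Real.cos (t * Real.sin (th n q) - m * th n q) := rfl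
    have hs : ∑ q ∈ Finset.range N, Real.exp (t * (Real.cos (th n (q + 1)) - Real.cos (Real.pi / n))) *
        Real.cos (t * Real.sin (th n (q + 1)) - m * th n (q + 1)) =
        (∑ q ∈ Finset.range N, Real.exp (t * Real.cos (th n (q + 1))) *
        Real.cos (t * Real.sin (th n (q + 1)) - m * th n (q + 1))) *
          Real.exp (-(t * Real.cos (Real.pi / n))) := by
      rw [Finset.sum_mul]
      refine Finset.sum_congr rfl fun q _ => ?_
      rw [mul_sub, sub_eq_add_neg, Real.exp_add]
      ring
    rw [hs, hGd, Finset.sum_range_succ, Finset.sum_range_succ', c1, c2, t0]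
    linear_combination (2 * Real.cos (t * Real.sin (Real.pi / n) - m * (Real.pi / n))) * e1
  simp_rw [hG]
  rw [show (0 : ℝ) = ∑ q ∈ Finset.range N, (0 : ℝ) by simp]
  apply tendsto_finsetSum
  intro q hq
  have hqN : q < N := Finset.mem_range.1 hq
  have hlt : Real.cos (th n (q + 1)) - Real.cos (Real.pi / n) < 0 := by
    have hqr : (q : ℝ) + 1 ≤ N := by exact_mod_cast hqN
    have hnr : (n : ℝ) = N + 2 := by rw [hnN]; push_cast; ring
    have ha : Real.pi / n < th n (q + 1) := by
      simp only [th]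
      push_cast
      gcongr
      nlinarith
    have hb : th n (q + 1) < 2 * Real.pi - Real.pi / n := by
      simp only [th]
      push_cast
      rw [div_lt_iff₀ hn0, sub_mul, div_mul_cancel₀ _ hn0.ne', hnr]
      nlinarith
    have hpn : Real.pi / n ≤ Real.pi := div_le_self hpi.le (by rw [hnr]; linarith)
    have hp0 : 0 < Real.pi / n := by positivity
    by_cases hle : th n (q + 1) ≤ Real.pi
    · have := Real.cos_lt_cos_of_nonneg_of_le_pi hp0.le hle ha
      linarith
    · push Not at hle
      have := Real.cos_lt_cos_of_nonneg_of_le_pi hp0.le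
        (show 2 * Real.pi - th n (q + 1) ≤ Real.pi by linarith) (by linarith)
      rw [Real.cos_two_pi_sub] at this
      linarith
  have hz : Tendsto (fun t : ℝ => Real.exp (t * (Real.cos (th n (q + 1)) - Real.cos (Real.pi / n))))
      atTop (𝓝 0) :=
    Real.tendsto_exp_atBot.comp (tendsto_id.atTop_mul_const_of_neg hlt)
  refine squeeze_zero_norm (fun t => ?_) hz
  rw [norm_mul, Real.norm_eq_abs, Real.norm_eq_abs, abs_of_pos (Real.exp_pos _)]
  exact mul_le_of_le_one_right (Real.exp_pos _).le (Real.abs_cos_le_one _)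

open Filter Topology in
lemma G_zeros (n m : ℕ) (hn : 2 ≤ n) (R : ℝ) : ∃ t, R < t ∧ 0 < t ∧ G n m t = 0 := by
  have h := G_asymp n m hn
  have hev : ∀ᶠ t in atTop, |G n m t * Real.exp (-(t * Real.cos (Real.pi / n))) -
      2 * Real.cos (t * Real.sin (Real.pi / n) - m * (Real.pi / n))| < 1 := by
    have := h.abs
    rw [abs_zero] at this
    exact this.eventually_lt_const one_pos
  obtain ⟨R1, hR1⟩ := eventually_atTop.1 hev
  have hn0 : (0 : ℝ) < n := by positivity
  have hn2 : (2 : ℝ) ≤ n := by exact_mod_cast hn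
  have hs : 0 < Real.sin (Real.pi / n) := by
    apply Real.sin_pos_of_pos_of_lt_pi (by positivity)
    exact div_lt_self Real.pi_pos (by linarith)
  set s := Real.sin (Real.pi / n) with hsdef
  set T : ℕ → ℝ := fun r => (r * Real.pi + m * (Real.pi / n)) / s with hT
  have hTt : Tendsto T atTop atTop := by
    apply Tendsto.atTop_div_const hs
    apply tendsto_atTop_add_const_right
    exact tendsto_natCast_atTop_atTop.atTop_mul_const Real.pi_pos
  obtain ⟨r0, hr0⟩ := eventually_atTop.1 (hTt.eventually_gt_atTop (max (max R R1) 0))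
  have hval : ∀ r, r0 ≤ r → |G n m (T r) * Real.exp (-(T r * Real.cos (Real.pi / n))) -
      2 * (-1) ^ r| < 1 := by
    intro r hr
    have h1 := hR1 (T r) (le_trans (le_trans (le_max_right _ _) (le_max_left _ _)) (hr0 r hr).le)
    have h2 : T r * s - m * (Real.pi / n) = r * Real.pi := by
      simp only [hT]
      field_simp
      ring
    rwa [h2, Real.cos_nat_mul_pi] at h1
  have hpos : 0 ≤ G n m (T (2 * r0)) := by
    have h1 := abs_lt.1 (hval (2 * r0) (by omega))
    rw [pow_mul] at h1
    norm_num at h1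
    by_contra hneg
    have := mul_neg_of_neg_of_pos (not_le.1 hneg) (Real.exp_pos (-(T (2 * r0) * Real.cos (Real.pi / n))))
    linarith [h1.1]
  have hneg : G n m (T (2 * r0 + 1)) ≤ 0 := by
    have h1 := abs_lt.1 (hval (2 * r0 + 1) (by omega))
    rw [pow_succ, pow_mul] at h1
    norm_num at h1
    by_contra hneg
    have := mul_pos (not_le.1 hneg) (Real.exp_pos (-(T (2 * r0 + 1) * Real.cos (Real.pi / n))))
    linarith [h1.2]
  have hle : T (2 * r0) ≤ T (2 * r0 + 1) := by
    simp only [hT]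
    have := Real.pi_pos
    gcongr
    linarith
  obtain ⟨t, ht, h0⟩ := intermediate_value_Icc' hle (G_cont n m).continuousOn ⟨hneg, hpos⟩
  have h3 := lt_of_lt_of_le (hr0 (2 * r0) (by omega)) ht.1
  exact ⟨t, lt_of_le_of_lt (le_trans (le_max_left _ _) (le_max_left _ _)) h3,
    lt_of_le_of_lt (le_max_right _ _) h3, h0⟩

lemma partB (n m : ℕ) (hn : 2 ≤ n) (hm : m < n) (x : ℝ) (hx : 0 < x) :
    {lam : ℂ | ∑' k : ℕ, (x : ℂ) ^ (n * k + m) * lam ^ k / ((n * k + m).factorial : ℂ) = 0}.Infinite := by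
  intro hfin
  obtain ⟨M, hM⟩ := (hfin.image (fun z : ℂ => ‖z‖)).bddAbove
  obtain ⟨t, ht, ht0, hG⟩ := G_zeros n m hn (x * max M 1)
  have htx : max M 1 < t / x := by rw [lt_div_iff₀ hx]; linarith
  have h1 : 1 ≤ t / x := (le_max_right _ _).trans htx.le
  have hbig : M < (t / x) ^ n :=
    lt_of_lt_of_le ((le_max_left _ _).trans_lt htx) (le_self_pow₀ h1 (by omega))
  have hmem : ∑' k : ℕ, (x : ℂ) ^ (n * k + m) * ((-(t / x) ^ n : ℝ) : ℂ) ^ k /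
      ((n * k + m).factorial : ℂ) = 0 := by
    have hs := G_hasSum n m hm t
    rw [hG] at hs
    have hs2 := hs.mul_left ((x / t) ^ m / n)
    rw [mul_zero] at hs2
    have hs3 := (Complex.hasSum_ofReal.2 hs2).tsum_eq
    rw [Complex.ofReal_zero] at hs3
    rw [← hs3]
    refine tsum_congr fun k => ?_
    have hn0 : (n : ℝ) ≠ 0 := by positivity
    rw [← Complex.ofReal_pow, ← Complex.ofReal_pow, ← Complex.ofReal_mul,
      ← Complex.ofReal_natCast, ← Complex.ofReal_div]
    congr 1
    rw [neg_pow, ← pow_mul, div_pow, div_pow, pow_add, pow_add]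
    field_simp
  have := hM ⟨_, hmem, rfl⟩
  simp only [Complex.norm_real, Real.norm_eq_abs, abs_neg] at this
  rw [abs_of_nonneg (by positivity)] at this
  linarith

end

end MLzeros


/-- Let `n ≥ 2`, fix a real `x > 0` and `j ∈ {1, …, n}`, and consider the entire function of
`λ` given by `ũ_j(x; λ) := Σ_{k=0}^∞ x^{nk+j−1} λ^k/(nk+j−1)!`.  Then every complex zero `λ`
of this function is real and negative, and the set of its zeros is infinite. -/
theorem stmt_8 (n : ℕ) (hn : 2 ≤ n) (x : ℝ) (hx : 0 < x) (j : ℕ) (hj1 : 1 ≤ j) (hjn : j ≤ n) :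
    let f : ℂ → ℂ := fun lam =>
      ∑' k : ℕ, (x : ℂ) ^ (n * k + j - 1) * lam ^ k / ((n * k + j - 1).factorial : ℂ)
    (∀ lam : ℂ, f lam = 0 → ∃ t : ℝ, t < 0 ∧ lam = (t : ℂ)) ∧
      {lam : ℂ | f lam = 0}.Infinite := by
  obtain ⟨m, rfl⟩ : ∃ m, j = m + 1 := ⟨j - 1, by omega⟩
  intro f
  have e : ∀ k, n * k + (m + 1) - 1 = n * k + m := fun k => by omega
  simp only [f, e]
  exact ⟨fun lam h => MLzeros.partA n m (by omega) x hx lam h,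
    MLzeros.partB n m hn (by omega) x hx⟩
end

section
/- Let n ≥ 2, fix a real λ < 0 and j ∈ {1, …, n}, and consider the function of x given by ũ_j(x; λ) := Σ_{k=0}^∞ x^{nk+j−1} λ^k/(nk+j−1)!. Then the set {x > 0 : ũ_j(x; λ) = 0} is infinite. -/
open Filter Topology in
lemma aux_pow_sum (n : ℕ) (hn : 2 ≤ n) (a : ℂ) (q : ℕ) (hq : ¬ n ∣ q) :
    ∑ m ∈ Finset.range n, (a * Complex.exp (2 * Real.pi * Complex.I / n) ^ m) ^ q = 0 := by
  have hp := Complex.isPrimitiveRoot_exp n (by omega)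
  set z := Complex.exp (2 * Real.pi * Complex.I / n) with hz
  have h1 : z ^ q ≠ 1 := fun h => hq (hp.dvd_of_pow_eq_one q h)
  have h2 : ∑ m ∈ Finset.range n, (z ^ q) ^ m = 0 := by
    rw [geom_sum_eq h1, ← pow_mul, mul_comm q n, pow_mul, hp.pow_eq_one]
    simp
  calc ∑ m ∈ Finset.range n, (a * z ^ m) ^ q = ∑ m ∈ Finset.range n, a ^ q * (z ^ q) ^ m := by
        refine Finset.sum_congr rfl fun m _ => ?_
        rw [mul_pow, ← pow_mul, ← pow_mul, mul_comm m q]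
    _ = 0 := by rw [← Finset.mul_sum, h2, mul_zero]

/-- The angles of the `n`-th roots of `-1`. -/
noncomputable def auxTh (n m : ℕ) : ℝ := (2 * m + 1) * Real.pi / n

lemma aux_hasSum (n : ℕ) (hn : 2 ≤ n) (lam r : ℝ) (hr : r ^ n = -lam) (j : ℕ)
    (hj1 : 1 ≤ j) (hjn : j ≤ n) (x : ℝ) :
    HasSum (fun k : ℕ => (n : ℂ) * lam *
        ((x ^ (n * k + j - 1) * lam ^ k / ((n * k + j - 1).factorial : ℝ) : ℝ) : ℂ))
      (∑ m ∈ Finset.range n, ((r : ℂ) * Complex.exp (auxTh n m * Complex.I)) ^ (n - j + 1) *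
        Complex.exp ((r : ℂ) * Complex.exp (auxTh n m * Complex.I) * x)) := by
  have hn0 : (n : ℂ) ≠ 0 := by
    have : n ≠ 0 := by omega
    exact_mod_cast this
  set μ : ℕ → ℂ := fun m => (r : ℂ) * Complex.exp (auxTh n m * Complex.I) with hμ
  have hμz : ∀ m, μ m = μ 0 * Complex.exp (2 * Real.pi * Complex.I / n) ^ m := by
    intro m
    simp only [hμ, auxTh]
    rw [mul_assoc, ← Complex.exp_nat_mul, ← Complex.exp_add]
    congr 2
    push_cast
    field_simp
    ring
  have hμn : ∀ m, μ m ^ n = lam := by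
    intro m
    simp only [hμ, auxTh]
    rw [mul_pow, ← Complex.exp_nat_mul]
    have : (n : ℂ) * (((2 * m + 1) * Real.pi / n : ℝ) * Complex.I)
        = m * (2 * Real.pi * Complex.I) + Real.pi * Complex.I := by
      push_cast
      field_simp
    rw [this, Complex.exp_add, Complex.exp_nat_mul_two_pi_mul_I, Complex.exp_pi_mul_I]
    have : (r : ℂ) ^ n = -lam := by exact_mod_cast hr
    rw [this]
    ring
  have hexp : ∀ z : ℂ, HasSum (fun p : ℕ => z ^ p / (p.factorial : ℂ)) (Complex.exp z) := by
    intro z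
    rw [Complex.exp_eq_exp_ℂ]
    exact NormedSpace.expSeries_div_hasSum_exp z
  have hS : HasSum (fun p : ℕ => ∑ m ∈ Finset.range n,
      μ m ^ (n - j + 1) * ((μ m * x) ^ p / (p.factorial : ℂ)))
      (∑ m ∈ Finset.range n, μ m ^ (n - j + 1) * Complex.exp (μ m * x)) :=
    hasSum_sum fun m _ => (hexp _).mul_left _
  have hinj : Function.Injective (fun k : ℕ => n * k + j - 1) := by
    intro a b hab
    have h : n * a + j - 1 = n * b + j - 1 := hab
    have h2 : n * a = n * b := by omega
    exact Nat.eq_of_mul_eq_mul_left (by omega) h2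
  have hterm : ∀ p, ∑ m ∈ Finset.range n,
      μ m ^ (n - j + 1) * ((μ m * x) ^ p / (p.factorial : ℂ)) =
      (∑ m ∈ Finset.range n, μ m ^ (n - j + 1 + p)) * ((x : ℂ) ^ p / (p.factorial : ℂ)) := by
    intro p
    rw [Finset.sum_mul]
    refine Finset.sum_congr rfl fun m _ => ?_
    rw [mul_pow, pow_add]
    ring
  have hsupp : ∀ p ∉ Set.range (fun k : ℕ => n * k + j - 1), ∑ m ∈ Finset.range n,
      μ m ^ (n - j + 1) * ((μ m * x) ^ p / (p.factorial : ℂ)) = 0 := by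
    intro p hp
    rw [hterm]
    have : ¬ n ∣ n - j + 1 + p := by
      rintro ⟨c, hc⟩
      apply hp
      rcases c with _ | c
      · simp at hc
      · refine ⟨c, ?_⟩
        have : n * (c + 1) = n * c + n := by ring
        show n * c + j - 1 = p
        omega
    have h0 := aux_pow_sum n hn (μ 0) _ this
    rw [Finset.sum_congr rfl (fun m _ => by rw [hμz m]), h0, zero_mul]
  have := (hinj.hasSum_iff hsupp).2 hS
  convert this using 1
  funext k
  simp only [Function.comp]
  rw [hterm]
  have he : n - j + 1 + (n * k + j - 1) = n * (k + 1) := by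
    have : n * (k + 1) = n * k + n := by ring
    omega
  rw [he, Finset.sum_congr rfl (fun m _ => by rw [pow_mul, hμn m])]
  simp
  ring

noncomputable def auxG (n s : ℕ) (r x : ℝ) (m : ℕ) : ℝ :=
  r ^ s * (Real.exp (r * x * Real.cos (auxTh n m)) *
    Real.cos (r * x * Real.sin (auxTh n m) + s * auxTh n m))

lemma aux_re (n s : ℕ) (r x : ℝ) (m : ℕ) :
    (((r : ℂ) * Complex.exp (auxTh n m * Complex.I)) ^ s *
        Complex.exp ((r : ℂ) * Complex.exp (auxTh n m * Complex.I) * x)).re = auxG n s r x m := by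
  rw [mul_pow, ← Complex.exp_nat_mul, mul_assoc, ← Complex.exp_add, ← Complex.ofReal_pow,
    Complex.re_ofReal_mul, Complex.exp_re, auxG]
  have h1 : ((s : ℂ) * (auxTh n m * Complex.I) +
      (r : ℂ) * Complex.exp (auxTh n m * Complex.I) * x)
      = ((r * x * Real.cos (auxTh n m) : ℝ) : ℂ) +
        ((r * x * Real.sin (auxTh n m) + s * auxTh n m : ℝ) : ℂ) * Complex.I := by
    rw [Complex.exp_mul_I]
    push_cast
    ring
  rw [h1]
  simp only [Complex.add_re, Complex.add_im, Complex.ofReal_re, Complex.ofReal_im,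
    Complex.re_ofReal_mul, Complex.im_ofReal_mul, Complex.I_re, Complex.I_im]
  simp

lemma aux_tsum (n : ℕ) (hn : 2 ≤ n) (lam r : ℝ) (hr : r ^ n = -lam) (j : ℕ)
    (hj1 : 1 ≤ j) (hjn : j ≤ n) (x : ℝ) :
    n * lam * (∑' k : ℕ, x ^ (n * k + j - 1) * lam ^ k / ((n * k + j - 1).factorial : ℝ)) =
      ∑ m ∈ Finset.range n, auxG n (n - j + 1) r x m := by
  have h := Complex.hasSum_re (aux_hasSum n hn lam r hr j hj1 hjn x)
  rw [Complex.re_sum, Finset.sum_congr rfl (fun m _ => aux_re n (n - j + 1) r x m)] at h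
  rw [← tsum_mul_left, ← h.tsum_eq]
  congr 1
  funext k
  rw [← Complex.ofReal_natCast, ← Complex.ofReal_mul, ← Complex.ofReal_mul, Complex.ofReal_re]

lemma aux_cos_lt (n m : ℕ) (h0 : 0 < m) (hm : m + 1 < n) :
    Real.cos (auxTh n m) < Real.cos (auxTh n 0) := by
  have hn : (0 : ℝ) < n := by
    have : 0 < n := by omega
    exact_mod_cast this
  have hpi := Real.pi_pos
  have hm0 : (1 : ℝ) ≤ m := by exact_mod_cast h0
  have hmn : (m : ℝ) + 1 + 1 ≤ n := by exact_mod_cast hm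
  have a0 : 0 < auxTh n 0 := by unfold auxTh; positivity
  have a1 : auxTh n 0 < auxTh n m := by
    unfold auxTh
    apply div_lt_div_of_pos_right _ hn
    push_cast
    nlinarith
  have a2 : auxTh n m < 2 * Real.pi - auxTh n 0 := by
    unfold auxTh
    rw [lt_sub_iff_add_lt, ← add_div, div_lt_iff₀ hn]
    push_cast
    nlinarith
  rcases le_total (auxTh n m) Real.pi with h | h
  · exact Real.cos_lt_cos_of_nonneg_of_le_pi a0.le h a1
  · rw [← Real.cos_two_pi_sub (auxTh n m)]
    exact Real.cos_lt_cos_of_nonneg_of_le_pi a0.le (by linarith) (by linarith)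

open Filter Topology in
lemma aux_tendsto (n s : ℕ) (hn : 2 ≤ n) (r : ℝ) (hr : 0 < r) :
    Tendsto (fun x => Real.exp (-(r * x * Real.cos (auxTh n 0))) *
        (∑ m ∈ Finset.range n, auxG n s r x m) -
      2 * r ^ s * Real.cos (r * x * Real.sin (auxTh n 0) + s * auxTh n 0)) atTop (𝓝 0) := by
  obtain ⟨N, rfl⟩ : ∃ N, n = N + 2 := ⟨n - 2, by omega⟩
  have hth : auxTh (N + 2) (N + 1) = 2 * Real.pi - auxTh (N + 2) 0 := by
    unfold auxTh
    push_cast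
    field_simp
    ring
  have hmid : ∀ m ∈ Finset.range N, Tendsto (fun x => Real.exp (-(r * x * Real.cos (auxTh (N+2) 0)))
      * auxG (N + 2) s r x (m + 1)) atTop (𝓝 0) := by
    intro m hm
    have hm := Finset.mem_range.1 hm
    have hc := aux_cos_lt (N + 2) (m + 1) (by omega) (by omega)
    set d := Real.cos (auxTh (N + 2) 0) - Real.cos (auxTh (N + 2) (m + 1)) with hd
    have hdpos : 0 < r * d := mul_pos hr (by linarith)
    have ht : Tendsto (fun x : ℝ => r ^ s * Real.exp (-(r * d * x))) atTop (𝓝 0) := by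
      have := (Real.tendsto_exp_neg_atTop_nhds_zero.comp
        (tendsto_id.const_mul_atTop hdpos)).const_mul (r ^ s)
      simpa using this
    refine squeeze_zero_norm (fun x => ?_) ht
    have : Real.exp (-(r * x * Real.cos (auxTh (N+2) 0))) * auxG (N + 2) s r x (m + 1)
        = r ^ s * Real.exp (-(r * d * x)) *
          Real.cos (r * x * Real.sin (auxTh (N+2) (m+1)) + s * auxTh (N+2) (m+1)) := by
      have he : Real.exp (-(r * d * x)) = Real.exp (-(r * x * Real.cos (auxTh (N+2) 0))) *
          Real.exp (r * x * Real.cos (auxTh (N+2) (m+1))) := by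
        rw [← Real.exp_add, hd]
        congr 1
        ring
      rw [he, auxG]
      ring
    rw [this, norm_mul, Real.norm_of_nonneg (by positivity)]
    exact mul_le_of_le_one_right (by positivity) (Real.abs_cos_le_one _)
  have hsum := tendsto_finsetSum (Finset.range N) hmid
  simp only [Finset.sum_const_zero] at hsum
  refine hsum.congr fun x => ?_
  rw [Finset.sum_range_succ, Finset.sum_range_succ', ← Finset.mul_sum]
  have hlast : auxG (N + 2) s r x (N + 1) = auxG (N + 2) s r x 0 := by
    unfold auxG
    rw [hth, Real.cos_two_pi_sub, Real.sin_two_pi_sub]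
    congr 2
    rw [show r * x * -Real.sin (auxTh (N + 2) 0) + s * (2 * Real.pi - auxTh (N + 2) 0)
      = s * (2 * Real.pi) - (r * x * Real.sin (auxTh (N + 2) 0) + s * auxTh (N + 2) 0) by ring,
      Real.cos_nat_mul_two_pi_sub]
  have h0 : Real.exp (-(r * x * Real.cos (auxTh (N+2) 0))) * auxG (N + 2) s r x 0 =
      r ^ s * Real.cos (r * x * Real.sin (auxTh (N+2) 0) + s * auxTh (N+2) 0) := by
    have he : Real.exp (-(r * x * Real.cos (auxTh (N+2) 0))) *
        Real.exp (r * x * Real.cos (auxTh (N+2) 0)) = 1 := by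
      rw [← Real.exp_add]
      simp
    rw [auxG]
    linear_combination (r ^ s * Real.cos (r * x * Real.sin (auxTh (N+2) 0) + s * auxTh (N+2) 0)) * he
  rw [hlast]
  linear_combination (-2) * h0

open Filter Topology in
/-- Let `n ≥ 2`, fix a real `λ < 0` and `j ∈ {1, …, n}`, and consider the function of `x`
given by `ũ_j(x; λ) := Σ_{k=0}^∞ x^{nk+j−1} λ^k/(nk+j−1)!`.  Then the set
`{x > 0 : ũ_j(x; λ) = 0}` is infinite. -/
theorem stmt_9 (n : ℕ) (hn : 2 ≤ n) (lam : ℝ) (hlam : lam < 0) (j : ℕ)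
    (hj1 : 1 ≤ j) (hjn : j ≤ n) :
    {x : ℝ | 0 < x ∧
      (∑' k : ℕ, x ^ (n * k + j - 1) * lam ^ k / ((n * k + j - 1).factorial : ℝ)) = 0}.Infinite := by
  have hn0 : n ≠ 0 := by omega
  have hnR : (2 : ℝ) ≤ n := by exact_mod_cast hn
  obtain ⟨r, hr, hrn⟩ : ∃ r : ℝ, 0 < r ∧ r ^ n = -lam :=
    ⟨(-lam) ^ ((n : ℝ)⁻¹), Real.rpow_pos_of_pos (by linarith) _,
      Real.rpow_inv_natCast_pow (by linarith) hn0⟩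
  set s := n - j + 1 with hs
  set G : ℝ → ℝ := fun x => ∑ m ∈ Finset.range n, auxG n s r x m with hG
  have hzero : ∀ x, G x = 0 →
      (∑' k : ℕ, x ^ (n * k + j - 1) * lam ^ k / ((n * k + j - 1).factorial : ℝ)) = 0 := by
    intro x hx
    have := aux_tsum n hn lam r hrn j hj1 hjn x
    rw [← hs] at this
    have h2 : (n : ℝ) * lam ≠ 0 := mul_ne_zero (by positivity) hlam.ne
    exact (mul_eq_zero.1 (this.trans hx)).resolve_left h2
  have hGc : Continuous G := by
    simp only [hG, auxG]
    fun_prop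
  have hsin : 0 < Real.sin (auxTh n 0) := by
    have hpi := Real.pi_pos
    apply Real.sin_pos_of_pos_of_lt_pi
    · unfold auxTh; positivity
    · unfold auxTh
      rw [div_lt_iff₀ (by linarith)]
      push_cast
      nlinarith
  have hw : 0 < r * Real.sin (auxTh n 0) := mul_pos hr hsin
  set w := r * Real.sin (auxTh n 0) with hwdef
  have hlim := aux_tendsto n s hn r hr
  have hrs : 0 < r ^ s := by positivity
  have hev := (tendsto_order.1 hlim)
  have hev1 := hev.1 (-(r ^ s)) (by linarith)
  have hev2 := hev.2 (r ^ s) hrs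
  obtain ⟨A, hA⟩ := eventually_atTop.1 (hev1.and hev2)
  apply Set.infinite_of_not_bddAbove
  rintro ⟨B, hB⟩
  set C := max A (max B 0 + 1) with hC
  obtain ⟨K, hK⟩ := exists_nat_ge ((w * C + s * auxTh n 0) / (2 * Real.pi))
  have hpi := Real.pi_pos
  rw [div_le_iff₀ (by positivity)] at hK
  set a := (K * (2 * Real.pi) - s * auxTh n 0) / w with ha
  set b := (K * (2 * Real.pi) + Real.pi - s * auxTh n 0) / w with hb
  have hab : a ≤ b := by
    rw [ha, hb]
    apply div_le_div_of_nonneg_right _ hw.le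
    linarith
  have hCa : C ≤ a := by
    rw [ha, le_div_iff₀ hw]
    linarith
  have hca : Real.cos (r * a * Real.sin (auxTh n 0) + s * auxTh n 0) = 1 := by
    have : r * a * Real.sin (auxTh n 0) + s * auxTh n 0 = K * (2 * Real.pi) := by
      have : a * w = K * (2 * Real.pi) - s * auxTh n 0 := div_mul_cancel₀ _ hw.ne'
      rw [hwdef] at this
      linear_combination this
    rw [this, Real.cos_nat_mul_two_pi]
  have hcb : Real.cos (r * b * Real.sin (auxTh n 0) + s * auxTh n 0) = -1 := by
    have : r * b * Real.sin (auxTh n 0) + s * auxTh n 0 = K * (2 * Real.pi) + Real.pi := by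
      have : b * w = K * (2 * Real.pi) + Real.pi - s * auxTh n 0 := div_mul_cancel₀ _ hw.ne'
      rw [hwdef] at this
      linear_combination this
    rw [this, Real.cos_nat_mul_two_pi_add_pi]
  have hAC : A ≤ C := le_max_left _ _
  have h1 := (hA a (hAC.trans hCa)).1
  have h2 := (hA b (hAC.trans (hCa.trans hab))).2
  rw [hca] at h1
  rw [hcb] at h2
  have hGa : 0 < G a := by
    have : 0 < Real.exp (-(r * a * Real.cos (auxTh n 0))) * G a := by
      simp only [hG]; linarith
    exact pos_of_mul_pos_right this (Real.exp_pos _).le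
  have hGb : G b < 0 := by
    have : Real.exp (-(r * b * Real.cos (auxTh n 0))) * G b < 0 := by
      simp only [hG]; linarith
    exact neg_of_mul_neg_right this (Real.exp_pos _).le
  obtain ⟨x, hx, hx0⟩ := intermediate_value_Icc' hab hGc.continuousOn ⟨hGb.le, hGa.le⟩
  have hCx : max B 0 + 1 ≤ x := (le_max_right _ _).trans (hCa.trans hx.1)
  have hB0 := le_max_left B 0
  have hB1 := le_max_right B 0
  have := hB (show x ∈ _ from ⟨by linarith, hzero x hx0⟩)
  linarith
end

section
/- Let n ≥ 2, b > 0, ρ := e^{2πi/n}, and let ζ ∈ ℂ, ζ ≠ 0. Then there exist indices j ≠ k in {0, 1, …, n−1} with exp(ρ^j ζ b) = exp(ρ^k ζ b) if and only if ζ^n = (−1)^d π^n m^n / (sin(πd/n)^n b^n) for some positive integer m and some d ∈ {1, …, n−1}. -/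
open Real

lemma key_aux (n d : ℕ) (hn : 2 ≤ n) :
    Complex.exp (2 * π * Complex.I / n) ^ d - 1 =
      Complex.exp (π * Complex.I / n) ^ d * (2 * Complex.I * (Real.sin (π * d / n) : ℂ)) := by
  have hn0 : (n : ℂ) ≠ 0 := by
    have : n ≠ 0 := by omega
    exact_mod_cast this
  rw [← Complex.exp_nat_mul, ← Complex.exp_nat_mul, Complex.ofReal_sin, Complex.sin]
  push_cast
  have e1 : (d : ℂ) * (2 * π * Complex.I / n) = d * (π * Complex.I / n) + d * (π * Complex.I / n) := by
    ring
  have e2 : -((π : ℂ) * d / n) * Complex.I = -(d * (π * Complex.I / n)) := by ring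
  have e3 : ((π : ℂ) * d / n) * Complex.I = (d * (π * Complex.I / n)) := by ring
  rw [e1, e2, e3, Complex.exp_add, Complex.exp_neg]
  have h0 := Complex.exp_ne_zero (d * (π * Complex.I / n))
  field_simp
  ring_nf
  rw [Complex.I_sq]
  ring

lemma w_pow_aux (n : ℕ) (hn : 2 ≤ n) : Complex.exp (π * Complex.I / n) ^ n = -1 := by
  have hn0 : (n : ℂ) ≠ 0 := by
    have : n ≠ 0 := by omega
    exact_mod_cast this
  rw [← Complex.exp_nat_mul, mul_div_cancel₀ _ hn0, Complex.exp_pi_mul_I]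

lemma sin_pos_aux (n d : ℕ) (hd : 1 ≤ d) (hdn : d < n) : 0 < Real.sin (π * d / n) := by
  have hn : (0 : ℝ) < n := by exact_mod_cast (by omega : 0 < n)
  have hd' : (0 : ℝ) < d := by exact_mod_cast hd
  have h : (d : ℝ) < n := by exact_mod_cast hdn
  apply Real.sin_pos_of_pos_of_lt_pi
  · positivity
  · rw [div_lt_iff₀ hn]
    exact mul_lt_mul_of_pos_left h Real.pi_pos

/-- The forward direction when `j = k + d`. -/
lemma fwd_aux (n : ℕ) (hn : 2 ≤ n) (b : ℝ) (hb : 0 < b) (ζ : ℂ) (hζ : ζ ≠ 0) (k d : ℕ)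
    (hd : 1 ≤ d) (hdn : d < n)
    (h : Complex.exp (Complex.exp (2 * π * Complex.I / n) ^ (k + d) * ζ * b) =
      Complex.exp (Complex.exp (2 * π * Complex.I / n) ^ k * ζ * b)) :
    ∃ m : ℕ, 0 < m ∧ ∃ d : ℕ, 1 ≤ d ∧ d ≤ n - 1 ∧
        ζ ^ n = (-1 : ℂ) ^ d * (π : ℂ) ^ n * (m : ℂ) ^ n /
          ((Real.sin (π * d / n) : ℂ) ^ n * (b : ℂ) ^ n) := by
  have hρ : Complex.exp (2 * π * Complex.I / n) ^ n = 1 :=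
    (Complex.isPrimitiveRoot_exp n (by omega)).pow_eq_one
  have hρ0 := Complex.exp_ne_zero (2 * π * Complex.I / n)
  have hk := key_aux n d hn
  have hw := w_pow_aux n hn
  have hw0 := Complex.exp_ne_zero (π * Complex.I / n)
  have hs : (Real.sin (π * d / n) : ℂ) ≠ 0 := by
    exact_mod_cast (sin_pos_aux n d hd hdn).ne'
  have hb0 : (b : ℂ) ≠ 0 := by exact_mod_cast hb.ne'
  have hs2 : Real.sin (π * (n - d : ℕ) / n) = Real.sin (π * d / n) := by
    have hn0 : (n : ℝ) ≠ 0 := by exact_mod_cast (by omega : n ≠ 0)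
    rw [← Real.sin_pi_sub]
    congr 1
    push_cast [hdn.le]
    field_simp
    ring
  obtain ⟨M, hM⟩ := Complex.exp_eq_exp_iff_exists_int.1 h
  generalize Complex.exp (2 * π * Complex.I / n) = ρ at *
  generalize Complex.exp (π * Complex.I / n) = w at *
  generalize hS : (Real.sin (π * d / n)) = S at *
  have h1 : ρ ^ k * w ^ d * S * ζ * b = π * M := by
    have h2I : (2 * Complex.I) ≠ 0 := by simp
    apply mul_left_cancel₀ h2I
    rw [pow_add] at hM
    linear_combination hM - ρ ^ k * ζ * b * hk
  have hM0 : M ≠ 0 := by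
    rintro rfl
    have : ρ ^ k * w ^ d * S * ζ * b ≠ 0 := by
      simp [hρ0, hw0, hs, hζ, hb0]
    apply this
    rw [h1]
    simp
  have h2 : (-1 : ℂ) ^ d * S ^ n * ζ ^ n * b ^ n = π ^ n * M ^ n := by
    have h3 := congrArg (· ^ n) h1
    simp only [mul_pow] at h3
    rw [← pow_mul ρ, mul_comm k, pow_mul, hρ, ← pow_mul w, mul_comm d, pow_mul w, hw, one_pow,
      one_mul] at h3
    exact h3
  have hsq : (-1 : ℂ) ^ d * (-1) ^ d = 1 := by rw [← mul_pow]; simp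
  rcases lt_or_gt_of_ne hM0 with hneg | hpos
  · refine ⟨M.natAbs, by omega, n - d, by omega, by omega, ?_⟩
    rw [hs2, eq_div_iff (by simp [hs, hb0])]
    have hMc : (M : ℂ) = -1 * (M.natAbs : ℂ) := by
      have : M = -1 * (M.natAbs : ℤ) := by omega
      generalize M.natAbs = a at this ⊢
      rw [this]
      push_cast
      ring
    rw [hMc, mul_pow] at h2
    have h5 : (-1 : ℂ) ^ n = (-1) ^ (n - d) * (-1) ^ d := by
      rw [← pow_add]; congr 1; omega
    rw [h5] at h2
    have h6 : (-1 : ℂ) ^ d ≠ 0 := by simp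
    apply mul_left_cancel₀ h6
    linear_combination h2
  · refine ⟨M.natAbs, by omega, d, by omega, by omega, ?_⟩
    rw [hS, eq_div_iff (by simp [hs, hb0])]
    have hMc : (M : ℂ) = (M.natAbs : ℂ) := by
      have : M = (M.natAbs : ℤ) := by omega
      generalize M.natAbs = a at this ⊢
      rw [this]
      simp
    rw [hMc] at h2
    linear_combination (-1 : ℂ) ^ d * h2 - ζ ^ n * (S ^ n * b ^ n) * hsq

/-- Let `n ≥ 2`, `b > 0`, `ρ := e^{2πi/n}`, and `ζ ∈ ℂ`, `ζ ≠ 0`.  Then there exist indices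
`j ≠ k` in `{0, …, n−1}` with `exp(ρ^j ζ b) = exp(ρ^k ζ b)` if and only if
`ζ^n = (−1)^d π^n m^n / (sin(πd/n)^n b^n)` for some positive integer `m` and some
`d ∈ {1, …, n−1}`. -/
theorem stmt_10 (n : ℕ) (hn : 2 ≤ n) (b : ℝ) (hb : 0 < b) (ζ : ℂ) (hζ : ζ ≠ 0) :
    let ρ : ℂ := Complex.exp (2 * π * Complex.I / n)
    (∃ j k : ℕ, j < n ∧ k < n ∧ j ≠ k ∧
        Complex.exp (ρ ^ j * ζ * b) = Complex.exp (ρ ^ k * ζ * b)) ↔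
      (∃ m : ℕ, 0 < m ∧ ∃ d : ℕ, 1 ≤ d ∧ d ≤ n - 1 ∧
        ζ ^ n = (-1 : ℂ) ^ d * (π : ℂ) ^ n * (m : ℂ) ^ n /
          ((Real.sin (π * d / n) : ℂ) ^ n * (b : ℂ) ^ n)) := by
  intro ρ
  constructor
  · rintro ⟨j, k, hj, hk, hjk, h⟩
    rcases lt_or_gt_of_ne hjk with hlt | hlt
    · refine fwd_aux n hn b hb ζ hζ j (k - j) (by omega) (by omega) ?_
      rw [show j + (k - j) = k by omega]
      exact h.symm
    · refine fwd_aux n hn b hb ζ hζ k (j - k) (by omega) (by omega) ?_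
      rw [show k + (j - k) = j by omega]
      exact h
  · rintro ⟨m, hm, d, hd, hdn, h⟩
    have hprim : IsPrimitiveRoot ρ n := Complex.isPrimitiveRoot_exp n (by omega)
    have hk : ρ ^ d - 1 = _ := key_aux n d hn
    have hw := w_pow_aux n hn
    have hs : (Real.sin (π * d / n) : ℂ) ≠ 0 := by
      exact_mod_cast (sin_pos_aux n d hd (by omega)).ne'
    have hb0 : (b : ℂ) ≠ 0 := by exact_mod_cast hb.ne'
    have hw0 := Complex.exp_ne_zero (π * Complex.I / n)
    have hπ : (π : ℂ) ≠ 0 := by exact_mod_cast Real.pi_ne_zero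
    have hm0 : (m : ℂ) ≠ 0 := by exact_mod_cast hm.ne'
    clear_value ρ
    generalize Complex.exp (π * Complex.I / n) = w at *
    generalize (Real.sin (π * d / n)) = S at *
    have hsq : (-1 : ℂ) ^ d * (-1) ^ d = 1 := by rw [← mul_pow]; simp
    rw [eq_div_iff (by simp [hs, hb0])] at h
    have hx : (π * m / (w ^ d * S * ζ * b)) ^ n = 1 := by
      rw [div_pow, div_eq_one_iff_eq (by simp [hs, hb0, hw0, hζ])]
      simp only [mul_pow]
      rw [← pow_mul w, mul_comm d, pow_mul w, hw]
      linear_combination (-(-1 : ℂ) ^ d) * h - π ^ n * m ^ n * hsq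
    haveI : NeZero n := ⟨by omega⟩
    obtain ⟨k, hkn, hkx⟩ := hprim.eq_pow_of_pow_eq_one hx
    rw [eq_div_iff (by simp [hs, hb0, hw0, hζ])] at hkx
    have hmod : ρ ^ ((k + d) % n) = ρ ^ (k + d) := by
      rw [← pow_mod_orderOf ρ (k + d), hprim.eq_orderOf]
    refine ⟨(k + d) % n, k, Nat.mod_lt _ (by omega), hkn, ?_, ?_⟩
    · intro he
      rcases lt_or_ge (k + d) n with h1 | h1
      · rw [Nat.mod_eq_of_lt h1] at he; omega
      · rw [Nat.mod_eq_sub_mod h1, Nat.mod_eq_of_lt (by omega)] at he; omega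
    · rw [hmod, Complex.exp_eq_exp_iff_exists_int]
      refine ⟨m, ?_⟩
      rw [pow_add]
      push_cast
      linear_combination ρ ^ k * ζ * b * hk + 2 * Complex.I * hkx
end

section
/- Let n ≥ 1 and let M : ℂ → (n × n complex matrices) be a matrix-valued function each of whose entries is an entire function of λ. Fix μ ∈ ℂ and let d := n − rank M(μ) (so the kernel of M(μ) has dimension d). Then the entire function H(λ) := det M(λ) satisfies H^{(k)}(μ) = 0 for every k = 0, 1, …, d−1; i.e. μ is a zero of det M of multiplicity at least d. In particular, the algebraic multiplicity m_a(μ) of μ as a zero of H is at least the geometric multiplicity m_g(μ) := dim ker M(μ). -/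
/-- Let `n ≥ 1` and let `M : ℂ → Matrix (Fin n) (Fin n) ℂ` have entries which are entire
functions of `λ`.  Fix `μ ∈ ℂ` and let `d := n − rank M(μ)` (the dimension of the kernel of
`M(μ)`).  Then the entire function `H(λ) := det M(λ)` satisfies `H^{(k)}(μ) = 0` for every
`k = 0, 1, …, d−1`; i.e. `μ` is a zero of `det M` of multiplicity at least `d`.  In
particular the algebraic multiplicity of `μ` as a zero of `H` is at least the geometric
multiplicity `dim ker M(μ)`. -/
theorem stmt_15 (n : ℕ) (hn : 1 ≤ n) (M : ℂ → Matrix (Fin n) (Fin n) ℂ)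
    (hM : ∀ i j : Fin n, Differentiable ℂ (fun lam : ℂ => M lam i j)) (μ : ℂ) :
    ∀ k : ℕ, k < n - (M μ).rank →
      iteratedDeriv k (fun lam : ℂ => (M lam).det) μ = 0 := by
  classical
  obtain ⟨L, L', D, hD⟩ :=
    Matrix.Pivot.exists_list_transvec_mul_mul_list_transvec_eq_diagonal (M μ)
  set P := (L.map Matrix.TransvectionStruct.toMatrix).prod with hP
  set Q := (L'.map Matrix.TransvectionStruct.toMatrix).prod with hQ
  have hPd : P.det = 1 := Matrix.TransvectionStruct.det_toMatrix_prod L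
  have hQd : Q.det = 1 := Matrix.TransvectionStruct.det_toMatrix_prod L'
  have hrank : (M μ).rank = Fintype.card {i // D i ≠ 0} := by
    rw [← Matrix.rank_diagonal, ← hD,
      Matrix.rank_mul_eq_left_of_isUnit_det _ _ (by rw [hQd]; exact isUnit_one),
      Matrix.rank_mul_eq_right_of_isUnit_det _ _ (by rw [hPd]; exact isUnit_one)]
  have hcard : n - (M μ).rank = (Finset.univ.filter (fun i => D i = 0)).card := by
    have h := Finset.card_filter_add_card_filter_not (s := (Finset.univ : Finset (Fin n)))
      (fun i => D i = 0)
    rw [hrank, Fintype.card_subtype]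
    simp only [Finset.card_univ, Fintype.card_fin] at h
    simp only [ne_eq]
    omega
  let N : ℂ → Matrix (Fin n) (Fin n) ℂ := fun z => P * M z * Q
  have hN : ∀ i j, Differentiable ℂ (fun z => N z i j) := by
    intro i j
    simp only [N, Matrix.mul_apply]
    fun_prop
  have hdetN : ∀ z, (N z).det = (M z).det := by
    intro z
    simp [N, Matrix.det_mul, hPd, hQd]
  let G : ℂ → Matrix (Fin n) (Fin n) ℂ := fun z => Matrix.of fun i j =>
    if D j = 0 then dslope (fun w => N w i j) μ z else N z i j
  have hG : ∀ i j, Differentiable ℂ (fun z => G z i j) := by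
    intro i j
    by_cases h : D j = 0
    · simp only [G, Matrix.of_apply, h, if_true]
      rw [← differentiableOn_univ, Complex.differentiableOn_dslope Filter.univ_mem]
      exact (hN i j).differentiableOn
    · simpa only [G, Matrix.of_apply, h, if_false] using hN i j
  have hNG : ∀ z, N z = G z * Matrix.diagonal (fun j => if D j = 0 then z - μ else 1) := by
    intro z
    ext i j
    rw [Matrix.mul_diagonal]
    by_cases h : D j = 0
    · have h0 : N μ i j = 0 := by
        simp only [N, hD, Matrix.diagonal_apply]
        split_ifs with hij
        · rw [hij, h]
        · rfl
      have h1 := sub_smul_dslope (fun w => N w i j) μ z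
      simp only [h0, sub_zero, smul_eq_mul] at h1
      simp only [G, Matrix.of_apply, h, if_true]
      rw [mul_comm, h1]
    · simp [G, h]
  have hdet : ∀ z, (M z).det = (z - μ) ^ (n - (M μ).rank) * (G z).det := by
    intro z
    rw [← hdetN, hNG, Matrix.det_mul, Matrix.det_diagonal, mul_comm, hcard]
    simp [Finset.prod_ite]
  have hdG : Differentiable ℂ (fun z => (G z).det) := by
    simp only [Matrix.det_apply]
    fun_prop
  have hdM : Differentiable ℂ (fun z => (M z).det) := by
    simp only [Matrix.det_apply]
    fun_prop
  rw [← natCast_le_analyticOrderAt_iff_iteratedDeriv_eq_zero (hdM.analyticAt μ),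
    natCast_le_analyticOrderAt (hdM.analyticAt μ)]
  exact ⟨fun z => (G z).det, hdG.analyticAt μ, Filter.Eventually.of_forall fun z => by
    simpa using hdet z⟩
end
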